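/- Let m be a positive integer and, for j = 1,…,m, let A_j ∈ ℂ^{s_j×s_j}, b_j ∈ ℂ^{s_j}, and w_j ∈ ℂ be such that I − w_j·A_j is invertible. Let S = s_1 + ⋯ + s_m, let 𝔄 ∈ ℂ^{S×S} be the block lower-triangular extended tableau matrix with diagonal blocks w_j·A_j and sub-diagonal blocks (i,j), i > j, equal to w_j·𝟙_{s_i}·b_jᵀ, and let 𝔟 ∈ ℂ^{S} be the concatenation of the vectors w_j·b_j. Then the ARK-form stability function of the extended tableau equals the product of the individual stability functions: 1 + 𝔟ᵀ(I_S − 𝔄)⁻¹𝟙_S = ∏_{j=1}^{m} (1 + w_j·b_jᵀ(I − w_j·A_j)⁻¹𝟙). -/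

import Mathlib

open Matrix

/-- The extended (GARK/ARK) tableau matrix of a sequential fractional-step method built from
`m` Runge–Kutta sub-integrators `(A_j, b_j)` with scalar weights `w_j`: the `S×S`
(`S = Σ_j s_j`) block lower-triangular matrix with `(j,j)` diagonal block `w_j·A_j`,
`(i,j)` block for `i > j` equal to `w_j·𝟙·b_jᵀ`, and zero blocks above the diagonal. -/
def extTableau {m : ℕ} (s : Fin m → ℕ)
    (A : ∀ j : Fin m, Matrix (Fin (s j)) (Fin (s j)) ℂ)
    (b : ∀ j : Fin m, Fin (s j) → ℂ) (w : Fin m → ℂ) :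
    Matrix ((j : Fin m) × Fin (s j)) ((j : Fin m) × Fin (s j)) ℂ :=
  fun p q =>
    if h : p.1 = q.1 then w q.1 * A q.1 (h ▸ p.2) q.2
    else if q.1 < p.1 then w q.1 * b q.1 q.2
    else 0

/-- The extended weight vector `𝔟`: the concatenation of the vectors `w_j·b_j`. -/
def extWeights {m : ℕ} (s : Fin m → ℕ)
    (b : ∀ j : Fin m, Fin (s j) → ℂ) (w : Fin m → ℂ) :
    ((j : Fin m) × Fin (s j)) → ℂ :=
  fun p => w p.1 * b p.1 p.2

theorem extTableau_mulVec {m : ℕ} (s : Fin m → ℕ)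
    (A : ∀ j : Fin m, Matrix (Fin (s j)) (Fin (s j)) ℂ)
    (b : ∀ j : Fin m, Fin (s j) → ℂ) (w : Fin m → ℂ)
    (x : ((j : Fin m) × Fin (s j)) → ℂ) (j : Fin m) (i : Fin (s j)) :
    (extTableau s A b w *ᵥ x) ⟨j, i⟩ =
      ((w j • A j) *ᵥ fun l => x ⟨j, l⟩) i +
        ∑ k ∈ Finset.Iio j, w k * (b k ⬝ᵥ fun l => x ⟨k, l⟩) := by
  have hblock : ∀ k, ∑ l, extTableau s A b w ⟨j, i⟩ ⟨k, l⟩ * x ⟨k, l⟩ =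
      (if j = k then ((w j • A j) *ᵥ fun l => x ⟨j, l⟩) i else 0) +
        if k < j then w k * (b k ⬝ᵥ fun l => x ⟨k, l⟩) else 0 := by
    intro k
    by_cases h : j = k
    · subst h
      simp [extTableau, mulVec, dotProduct]
    · by_cases hk : k < j <;>
        simp [extTableau, dotProduct, h, hk, Finset.mul_sum, mul_assoc]
  have hIio : Finset.Iio j = Finset.univ.filter (· < j) := by ext; simp
  rw [hIio, Finset.sum_filter, mulVec, dotProduct, Fintype.sum_sigma]
  simp_rw [hblock, Finset.sum_add_distrib, Finset.sum_ite_eq, Finset.mem_univ, if_true]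

theorem one_sub_extTableau_mulVec {m : ℕ} (s : Fin m → ℕ)
    (A : ∀ j : Fin m, Matrix (Fin (s j)) (Fin (s j)) ℂ)
    (b : ∀ j : Fin m, Fin (s j) → ℂ) (w : Fin m → ℂ)
    (x : ((j : Fin m) × Fin (s j)) → ℂ) (j : Fin m) (i : Fin (s j)) :
    ((1 - extTableau s A b w) *ᵥ x) ⟨j, i⟩ =
      ((1 - w j • A j) *ᵥ fun l => x ⟨j, l⟩) i -
        ∑ k ∈ Finset.Iio j, w k * (b k ⬝ᵥ fun l => x ⟨k, l⟩) := by
  simp only [sub_mulVec, one_mulVec, Pi.sub_apply, extTableau_mulVec, sub_sub]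

theorem isUnit_one_sub_extTableau {m : ℕ} (s : Fin m → ℕ)
    (A : ∀ j : Fin m, Matrix (Fin (s j)) (Fin (s j)) ℂ)
    (b : ∀ j : Fin m, Fin (s j) → ℂ) (w : Fin m → ℂ)
    (hinv : ∀ j : Fin m, IsUnit (1 - w j • A j)) :
    IsUnit (1 - extTableau s A b w) := by
  rw [← mulVec_injective_iff_isUnit, ← coe_mulVecLin, injective_iff_map_eq_zero]
  intro x hx
  rw [mulVecLin_apply] at hx
  have hzero : ∀ j, (fun l => x ⟨j, l⟩) = 0 := by
    intro j
    induction j using WellFoundedLT.induction with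
    | ind j ih =>
      apply mulVec_injective_iff_isUnit.mpr (hinv j)
      ext i
      have h := congrFun hx ⟨j, i⟩
      rw [one_sub_extTableau_mulVec, Finset.sum_eq_zero fun k hk => by
        rw [ih k (Finset.mem_Iio.mp hk), dotProduct_zero, mul_zero], sub_zero] at h
      simpa using h
  ext ⟨j, i⟩
  exact congrFun (hzero j) i

/-- The ARK-form stability function of the extended tableau equals the
product of the individual stability functions:
`1 + 𝔟ᵀ(I_S − 𝔄)⁻¹𝟙_S = ∏_j (1 + w_j·b_jᵀ(I − w_j·A_j)⁻¹𝟙)`. -/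
theorem stmt3 {m : ℕ} (hm : 0 < m) (s : Fin m → ℕ)
    (A : ∀ j : Fin m, Matrix (Fin (s j)) (Fin (s j)) ℂ)
    (b : ∀ j : Fin m, Fin (s j) → ℂ) (w : Fin m → ℂ)
    (hinv : ∀ j : Fin m, IsUnit (1 - w j • A j)) :
    1 + (extWeights s b w ⬝ᵥ ((1 - extTableau s A b w)⁻¹ *ᵥ (fun _ => (1 : ℂ)))) =
      ∏ j : Fin m, (1 + w j * (b j ⬝ᵥ ((1 - w j • A j)⁻¹ *ᵥ (fun _ => (1 : ℂ))))) := by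
  set y : ∀ j, Fin (s j) → ℂ := fun j => (1 - w j • A j)⁻¹ *ᵥ fun _ => (1 : ℂ)
  set g : Fin m → ℂ := fun j => w j * (b j ⬝ᵥ y j) with hg
  set P : Fin m → ℂ := fun j => ∏ k with k < j, (1 + g k) with hP
  set x : ((j : Fin m) × Fin (s j)) → ℂ := fun p => P p.1 * y p.1 p.2
  have hx : ∀ k, w k * (b k ⬝ᵥ fun l => x ⟨k, l⟩) = g k * P k := by
    intro k
    rw [show (fun l => x ⟨k, l⟩) = P k • y k from rfl, dotProduct_smul, smul_eq_mul, hg]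
    ring
  have hsolve : (1 - extTableau s A b w) *ᵥ x = fun _ => 1 := by
    ext ⟨j, i⟩
    have hy : (1 - w j • A j) *ᵥ y j = fun _ => 1 := by
      rw [mulVec_mulVec, mul_nonsing_inv _ ((isUnit_iff_isUnit_det _).mp (hinv j)), one_mulVec]
    have hsum : 1 + ∑ k ∈ Finset.Iio j, g k * P k = P j := by
      have hIio : Finset.Iio j = Finset.univ.filter (· < j) := by ext; simp
      rw [hIio, hP]
      simp only
      rw [Finset.prod_one_add_ordered]
      congr 1
      refine Finset.sum_congr rfl fun k hk => ?_
      congr 2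
      ext l
      simp only [Finset.mem_filter, Finset.mem_univ, true_and] at hk ⊢
      exact ⟨fun h => ⟨h.trans hk, h⟩, And.right⟩
    rw [one_sub_extTableau_mulVec, Finset.sum_congr rfl fun k _ => hx k,
      show (fun l => x ⟨j, l⟩) = P j • y j from rfl, mulVec_smul, hy, ← hsum]
    simp
  have hinvx : (1 - extTableau s A b w)⁻¹ *ᵥ (fun _ => (1 : ℂ)) = x := by
    rw [← hsolve, mulVec_mulVec, nonsing_inv_mul _
      ((isUnit_iff_isUnit_det _).mp (isUnit_one_sub_extTableau s A b w hinv)), one_mulVec]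
  rw [hinvx, Finset.prod_one_add_ordered, dotProduct, Fintype.sum_sigma]
  congr 1
  refine Finset.sum_congr rfl fun k _ => ?_
  rw [← hx k, dotProduct, Finset.mul_sum]
  exact Finset.sum_congr rfl fun l _ => mul_assoc _ _ _
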